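/- arXiv:1602.02429 — 2 statements merged into one kernel-verified Lean document; each statement's English description precedes it below -/
import Mathlib

section
/- Let H be a separable infinite-dimensional complex Hilbert space. There exists a family (P_α)_{α<ω₁} of projections in B(H), none of which is compact, such that P_α P_β is compact and P_α − P_β is not compact for all distinct α, β < ω₁, and such that for every uncountable set S ⊆ ω₁ there is no family (T_α)_{α∈S} of pairwise commuting bounded operators in B(H) with T_α − P_α compact for every α ∈ S. -/
open scoped Ordinal
open Filter Topology

/-- The set of places at which a partial two-colouring of `ℕ` is defined. -/
def colourSupport (s : ℕ → Option Bool) : Set ℕ := {k | s k ≠ none}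

/-- Both partial two-colourings are defined at `k`, with different colours. -/
def ColourConflict (s t : ℕ → Option Bool) (k : ℕ) : Prop :=
  ∃ b, s k = some (!b) ∧ t k = some b

/-- A family of partial two-colourings of `ℕ` with infinite, pairwise almost disjoint domains. -/
structure IsAlmostDisjointFamily (F : Set (ℕ → Option Bool)) : Prop where
  infinite : ∀ s ∈ F, (colourSupport s).Infinite
  finite_inter : ∀ s ∈ F, ∀ t ∈ F, s ≠ t → (colourSupport s ∩ colourSupport t).Finite

/-- The partial colouring with constant colour on the `n`-th column of the Cantor pairing. -/
def columnColouring (n k : ℕ) : Option Bool :=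
  if k.unpair.1 = n then some false else none

lemma columnColouring_injective : Function.Injective columnColouring := by
  intro m n h
  have := congrFun h (Nat.pair m 0)
  simp [columnColouring] at this
  exact this

lemma isAlmostDisjointFamily_range_columnColouring :
    IsAlmostDisjointFamily (Set.range columnColouring) where
  infinite := by
    rintro _ ⟨n, rfl⟩
    refine Set.infinite_of_injective_forall_mem (f := Nat.pair n) ?_ ?_
    · intro a b h
      simpa using h
    · intro a
      simp [colourSupport, columnColouring]
  finite_inter := by
    rintro _ ⟨m, rfl⟩ _ ⟨n, rfl⟩ h
    convert Set.finite_empty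
    ext k
    simp only [colourSupport, columnColouring, Set.mem_inter_iff, Set.mem_ofPred_eq, ne_eq,
      ite_eq_right_iff, reduceCtorEq, imp_false, not_not, Set.mem_empty_iff_false, iff_false,
      not_and]
    rintro rfl h'
    exact h (by rw [h'])

lemma IsAlmostDisjointFamily.exists_fresh {X : ℕ → ℕ → Option Bool}
    (hX : Function.Injective X) (hF : IsAlmostDisjointFamily (Set.range X)) (n : ℕ) :
    ∃ k, n ≤ k ∧ X n k ≠ none ∧ ∀ i < n, X i k = none := by
  have hfin : (⋃ i ∈ Set.Iio n, colourSupport (X n) ∩ colourSupport (X i)).Finite :=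
    (Set.finite_Iio n).biUnion fun i hi ↦
      hF.finite_inter _ ⟨n, rfl⟩ _ ⟨i, rfl⟩ (hX.ne (ne_of_gt hi))
  obtain ⟨k, hk, hk'⟩ :=
    ((hF.infinite _ ⟨n, rfl⟩).sdiff (hfin.union (Set.finite_Iio n))).nonempty
  simp only [colourSupport, Set.mem_union, Set.mem_iUnion, Set.mem_inter_iff, Set.mem_ofPred_eq,
    Set.mem_Iio, not_or, not_exists, not_lt] at hk hk'
  refine ⟨k, hk'.2, hk, fun i hi ↦ ?_⟩
  by_contra h
  exact hk'.1 i hi ⟨hk, h⟩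

/-- Luzin's diagonal step for a countable almost disjoint family. -/
lemma IsAlmostDisjointFamily.exists_extension {F : Set (ℕ → Option Bool)}
    (hF : IsAlmostDisjointFamily F) (hc : F.Countable) (hi : F.Infinite) :
    ∃ g, (colourSupport g).Infinite ∧
      (∀ s ∈ F, (colourSupport s ∩ colourSupport g).Finite) ∧
      ∀ N, {s ∈ F | ∀ k ≥ N, ¬ ColourConflict g s k}.Finite := by
  have := hc.to_subtype
  have := hi.to_subtype
  obtain ⟨e⟩ := nonempty_equiv_of_countable (α := ℕ) (β := F)
  set X : ℕ → ℕ → Option Bool := fun n ↦ e n with hXdef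
  have hX : Function.Injective X := Subtype.val_injective.comp e.injective
  have hr : Set.range X = F := by
    rw [hXdef]
    exact (e.surjective.range_comp _).trans Subtype.range_val
  rw [← hr] at hF ⊢
  choose k hle hsome hnone using hF.exists_fresh hX
  have hk : Function.Injective k := by
    refine Function.Injective.of_lt_imp_ne fun m n hmn h ↦ hsome m ?_
    rw [h]
    exact hnone n m hmn
  set g : ℕ → Option Bool := Function.extend k (fun n ↦ (X n (k n)).map (!·)) fun _ ↦ none
  have hg (n) : g (k n) = (X n (k n)).map (!·) := hk.extend_apply _ _ n
  have hg' (j) (hj : g j ≠ none) : ∃ n, k n = j := by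
    by_contra h
    exact hj (Function.extend_apply' _ _ _ h)
  refine ⟨g, Set.infinite_of_injective_forall_mem hk fun n ↦ ?_, ?_, fun N ↦ ?_⟩
  · simpa [colourSupport, hg] using hsome n
  · rintro _ ⟨i, rfl⟩
    refine ((Set.finite_Iic i).image k).subset ?_
    rintro j ⟨hj, hj'⟩
    obtain ⟨n, rfl⟩ := hg' j hj'
    refine ⟨n, ?_, rfl⟩
    by_contra h
    exact hj (hnone n i (not_le.1 h))
  · refine ((Set.finite_Iio N).image X).subset ?_
    rintro _ ⟨⟨n, rfl⟩, hn⟩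
    refine ⟨n, ?_, rfl⟩
    by_contra h
    obtain ⟨b, hb⟩ := Option.ne_none_iff_exists'.1 (hsome n)
    exact hn (k n) ((not_lt.1 h).trans (hle n)) ⟨b, by simp [hg, hb], hb⟩

/-- A Luzin-type family of partial two-colourings of `ℕ`. -/
lemma exists_luzin_colourings {ι : Type*} [LinearOrder ι] [WellFoundedLT ι]
    (hι : ∀ a : ι, (Set.Iio a).Countable) :
    ∃ A : ι → ℕ → Option Bool, (∀ a, (colourSupport (A a)).Infinite) ∧
      (∀ a b, a ≠ b → (colourSupport (A a) ∩ colourSupport (A b)).Finite) ∧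
      ∀ a N, {b | b < a ∧ ∀ k ≥ N, ¬ ColourConflict (A a) (A b) k}.Finite := by
  choose! G hG using fun (F : Set (ℕ → Option Bool))
    (h : IsAlmostDisjointFamily F ∧ F.Countable ∧ F.Infinite) ↦
      h.1.exists_extension h.2.1 h.2.2
  obtain ⟨A, hA⟩ : ∃ A : ι → ℕ → Option Bool,
      ∀ a, A a = G (Set.range columnColouring ∪ A '' Set.Iio a) := by
    refine ⟨wellFounded_lt.fix fun a A ↦
      G (Set.range columnColouring ∪ {s | ∃ b, ∃ h : b < a, A b h = s}), fun a ↦ ?_⟩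
    rw [WellFounded.fix_eq]
    congr 2
    ext s
    simp
  set F : ι → Set (ℕ → Option Bool) := fun a ↦ Set.range columnColouring ∪ A '' Set.Iio a
  have hF (a) : IsAlmostDisjointFamily (F a) ∧ (F a).Countable ∧ (F a).Infinite := by
    refine ⟨?_, (Set.countable_range _).union ((hι a).image _),
      (Set.infinite_range_of_injective columnColouring_injective).mono Set.subset_union_left⟩
    induction a using WellFoundedLT.induction with
    | ind a ih =>
      have hext (b) (hb : b < a) := hG (F b) ⟨ih b hb, (Set.countable_range _).union
        ((hι b).image _), (Set.infinite_range_of_injective columnColouring_injective).mono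
          Set.subset_union_left⟩
      simp only [F, ← hA] at hext
      constructor
      · rintro s (hs | ⟨b, hb, rfl⟩)
        · exact isAlmostDisjointFamily_range_columnColouring.infinite s hs
        · exact (hext b hb).1
      · rintro s (hs | ⟨b, hb, rfl⟩) t (ht | ⟨c, hc, rfl⟩) hst
        · exact isAlmostDisjointFamily_range_columnColouring.finite_inter s hs t ht hst
        · exact (hext c hc).2.1 s (Or.inl hs)
        · rw [Set.inter_comm]
          exact (hext b hb).2.1 t (Or.inl ht)
        · rcases lt_trichotomy b c with h | rfl | h
          · exact (hext c hc).2.1 _ (Or.inr ⟨b, h, rfl⟩)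
          · exact absurd rfl hst
          · rw [Set.inter_comm]
            exact (hext b hb).2.1 _ (Or.inr ⟨c, h, rfl⟩)
  have hext (a) := hG (F a) (hF a)
  simp only [F, ← hA] at hext
  have hlt (a b) (h : a < b) : (colourSupport (A a) ∩ colourSupport (A b)).Finite :=
    (hext b).2.1 _ (Or.inr ⟨a, h, rfl⟩)
  have had (a b) (h : a ≠ b) : (colourSupport (A a) ∩ colourSupport (A b)).Finite := by
    rcases h.lt_or_gt with h | h
    · exact hlt a b h
    · rw [Set.inter_comm]
      exact hlt b a h
  have hinj : Function.Injective A := by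
    intro a b h
    by_contra hab
    have := had a b hab
    rw [h, Set.inter_self] at this
    exact (hext b).1 this
  refine ⟨A, fun a ↦ (hext a).1, had, fun a N ↦ ?_⟩
  refine (((hext a).2.2 N).preimage hinj.injOn).subset ?_
  rintro b ⟨hb, hk⟩
  exact ⟨Or.inr ⟨b, hb, rfl⟩, hk⟩

/-- An uncountable set in a linear order with countable initial segments has an element with
infinitely many predecessors in the set. -/
lemma exists_infinite_inter_Iio {ι : Type*} [LinearOrder ι]
    (hι : ∀ a : ι, (Set.Iio a).Countable) {S : Set ι} (hS : ¬ S.Countable) :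
    ∃ a ∈ S, (S ∩ Set.Iio a).Infinite := by
  have hinf : S.Infinite := fun h ↦ hS h.countable
  obtain ⟨f, hfS⟩ : ∃ f : ℕ → S, Function.Injective f :=
    have := hinf.to_subtype
    ⟨Infinite.natEmbedding S, (Infinite.natEmbedding S).injective⟩
  by_contra! h
  refine hS ((Set.countable_iUnion fun n ↦ ((hι (f n)).insert (f n : ι))).mono fun a ha ↦ ?_)
  by_contra hn
  simp only [Set.mem_iUnion, Set.mem_insert_iff, Set.mem_Iio, not_exists, not_or, not_lt] at hn
  exact Set.infinite_of_injective_forall_mem (s := S ∩ Set.Iio a)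
    (Subtype.val_injective.comp hfS)
    (fun n ↦ ⟨(f n).2, (hn n).2.lt_of_ne' (hn n).1⟩) (h a ha)

lemma countable_Iio_of_lt_omega_one (a : {α : Ordinal // α < ω₁}) : (Set.Iio a).Countable := by
  have : (Set.Iio a.1).Countable := by
    rw [← Cardinal.le_aleph0_iff_set_countable, Cardinal.mk_Iio_ordinal, Cardinal.lift_le_aleph0,
      ← Cardinal.lt_aleph_one_iff, ← Cardinal.lt_ord, Cardinal.ord_aleph]
    exact a.2
  exact (this.preimage Subtype.val_injective).mono fun b hb ↦ hb

/-- A compact operator maps orthonormal sequences to null sequences. -/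
lemma IsCompactOperator.tendsto_orthonormal {H : Type*} [NormedAddCommGroup H]
    [InnerProductSpace ℂ H] [CompleteSpace H] {K : H →L[ℂ] H} (hK : IsCompactOperator K)
    {u : ℕ → H} (hu : Orthonormal ℂ u) : Tendsto (fun n ↦ K (u n)) atTop (𝓝 0) := by
  obtain ⟨C, hC, hsub⟩ := IsCompactOperator.image_closedBall_subset_compact
    (f := (K : H →ₗ[ℂ] H)) hK 1
  refine tendsto_of_subseq_tendsto fun ns hns ↦ ?_
  obtain ⟨y, -, φ, hφ, hy⟩ := hC.tendsto_subseq (x := fun n ↦ K (u (ns n)))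
    fun n ↦ hsub ⟨u (ns n), by simp [hu.1], rfl⟩
  refine ⟨φ, ?_⟩
  have hweak : Tendsto (fun n ↦ inner ℂ (u n) (K.adjoint y)) atTop (𝓝 0) := by
    have h := (hu.inner_products_summable (K.adjoint y)).tendsto_atTop_zero
    rw [tendsto_zero_iff_norm_tendsto_zero]
    simpa using h.sqrt
  have h1 : Tendsto (fun n ↦ inner ℂ (K (u (ns (φ n)))) y) atTop (𝓝 (inner ℂ y y)) :=
    hy.inner tendsto_const_nhds
  have h2 : Tendsto (fun n ↦ inner ℂ (K (u (ns (φ n)))) y) atTop (𝓝 0) := by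
    simpa [Function.comp_def, ContinuousLinearMap.adjoint_inner_right] using
      hweak.comp (hns.comp hφ.tendsto_atTop)
  have : y = 0 := inner_self_eq_zero.1 (tendsto_nhds_unique h1 h2)
  simpa [this, Function.comp_def] using hy

lemma ContinuousLinearMap.isCompactOperator_of_forall_mem {𝕜 E F : Type*} [RCLike 𝕜]
    [NormedAddCommGroup E] [NormedSpace 𝕜 E] [NormedAddCommGroup F] [NormedSpace 𝕜 F]
    (T : E →L[𝕜] F) (W : Submodule 𝕜 F) [FiniteDimensional 𝕜 W] (h : ∀ x, T x ∈ W) :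
    IsCompactOperator T := by
  have : ProperSpace W := FiniteDimensional.proper 𝕜 W
  exact (isCompactOperator_of_locallyCompactSpace_dom (T.codRestrict W h)).clm_comp W.subtypeL

lemma exists_orthonormal_nat {H : Type*} [NormedAddCommGroup H] [InnerProductSpace ℂ H]
    [CompleteSpace H] (hH : ¬ FiniteDimensional ℂ H) : ∃ e : ℕ → H, Orthonormal ℂ e := by
  obtain ⟨w, b, -⟩ := exists_hilbertBasis ℂ H
  have : Infinite w := by
    by_contra hw
    have := not_infinite_iff_finite.1 hw
    have := Fintype.ofFinite w
    exact hH b.toOrthonormalBasis.toBasis.finiteDimensional_of_finite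
  exact ⟨_, b.orthonormal.comp _ (Infinite.natEmbedding w).injective⟩

/-- Two orthonormal sequences whose `k`-th vectors span mutually orthogonal planes, and meet at
an angle with cosine `3 / 5`. -/
def IsTiltedPair {H : Type*} [NormedAddCommGroup H] [InnerProductSpace ℂ H]
    (f : Bool → ℕ → H) : Prop :=
  ∀ b b' j k, inner ℂ (f b j) (f b' k) = if j = k then if b = b' then 1 else 3 / 5 else 0

set_option linter.unusedSimpArgs false in
lemma exists_isTiltedPair {H : Type*} [NormedAddCommGroup H] [InnerProductSpace ℂ H]
    [CompleteSpace H] (hH : ¬ FiniteDimensional ℂ H) : ∃ f : Bool → ℕ → H, IsTiltedPair f := by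
  obtain ⟨e, he⟩ := exists_orthonormal_nat hH
  rw [orthonormal_iff_ite] at he
  refine ⟨fun b k ↦ if b then (3 / 5 : ℂ) • e (2 * k) + (4 / 5 : ℂ) • e (2 * k + 1)
    else e (2 * k), fun b b' j k ↦ ?_⟩
  have h1 : 2 * j ≠ 2 * k + 1 := by omega
  have h2 : 2 * j + 1 ≠ 2 * k := by omega
  by_cases hjk : j = k <;> cases b <;> cases b' <;>
    simp [-inner_self_eq_norm_sq_to_K, inner_add_left, inner_add_right, inner_smul_left,
      inner_smul_right, he, h1, h2, hjk]
  all_goals norm_num [Complex.ext_iff]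

section

variable {H : Type*} [NormedAddCommGroup H] [InnerProductSpace ℂ H] {f : Bool → ℕ → H}

lemma IsTiltedPair.orthonormal (hf : IsTiltedPair f) (b : Bool) : Orthonormal ℂ (f b) := by
  rw [orthonormal_iff_ite]
  intro j k
  simp [hf b b j k]

/-- The closed span of the vectors `f b k` selected by `s k = some b`. -/
def colourSpan (f : Bool → ℕ → H) (s : ℕ → Option Bool) : Submodule ℂ H :=
  (Submodule.span ℂ {x | ∃ k b, s k = some b ∧ f b k = x}).topologicalClosure

variable {s t : ℕ → Option Bool} {k : ℕ}

lemma mem_orthogonal_colourSpan {x : H}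
    (h : ∀ k b, s k = some b → inner ℂ (f b k) x = 0) : x ∈ (colourSpan f s)ᗮ := by
  rw [colourSpan, Submodule.orthogonal_closure, Submodule.mem_orthogonal]
  intro u hu
  induction hu using Submodule.span_induction with
  | mem u hu =>
    obtain ⟨k, b, hb, rfl⟩ := hu
    exact h k b hb
  | zero => simp
  | add u v _ _ hu hv => simp [inner_add_left, hu, hv]
  | smul c u _ hu => simp [inner_smul_left, hu]

lemma mem_colourSpan {b : Bool} (h : s k = some b) : f b k ∈ colourSpan f s :=
  Submodule.le_topologicalClosure _ (Submodule.subset_span ⟨k, b, h, rfl⟩)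

variable [CompleteSpace H]

instance (f : Bool → ℕ → H) (s : ℕ → Option Bool) : CompleteSpace (colourSpan f s) :=
  (Submodule.isClosed_topologicalClosure _).completeSpace_coe

/-- The orthogonal projection onto `colourSpan f s`. -/
noncomputable def colourProj (f : Bool → ℕ → H) (s : ℕ → Option Bool) : H →L[ℂ] H :=
  (colourSpan f s).starProjection

lemma colourProj_apply_of_none (hf : IsTiltedPair f) (h : s k = none) (b : Bool) :
    colourProj f s (f b k) = 0 := by
  rw [colourProj, Submodule.starProjection_apply_eq_zero_iff]
  refine mem_orthogonal_colourSpan fun j c hj ↦ ?_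
  rw [hf, if_neg]
  rintro rfl
  simp [h] at hj

lemma colourProj_apply_of_some (hf : IsTiltedPair f) {b : Bool} (h : s k = some b) (c : Bool) :
    colourProj f s (f c k) = inner ℂ (f b k) (f c k) • f b k := by
  refine (Submodule.eq_starProjection_of_mem_orthogonal
    (Submodule.smul_mem _ _ (mem_colourSpan h)) ?_)
  refine mem_orthogonal_colourSpan fun j d hj ↦ ?_
  rw [inner_sub_right, inner_smul_right, hf, hf, hf]
  by_cases hjk : j = k
  · subst hjk
    obtain rfl : b = d := by simpa [h] using hj
    simp
  · simp [hjk]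

lemma isCompactOperator_colourProj_mul (hf : IsTiltedPair f)
    (h : (colourSupport s ∩ colourSupport t).Finite) :
    IsCompactOperator (colourProj f s * colourProj f t : H →L[ℂ] H) := by
  set D : Set H := (fun p : Bool × ℕ ↦ f p.1 p.2) ''
    (Set.univ ×ˢ (colourSupport s ∩ colourSupport t))
  have hD : D.Finite := (Set.finite_univ.prod h).image _
  have := FiniteDimensional.span_of_finite ℂ hD
  refine ContinuousLinearMap.isCompactOperator_of_forall_mem _ (Submodule.span ℂ D) fun x ↦ ?_
  have hle : colourSpan f t ≤
      (Submodule.span ℂ D).comap (colourProj f s).toLinearMap := by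
    refine Submodule.topologicalClosure_minimal _ (Submodule.span_le.2 ?_)
      ((Submodule.closed_of_finiteDimensional (Submodule.span ℂ D)).preimage (colourProj f s).continuous)
    rintro _ ⟨k, b, hb, rfl⟩
    change colourProj f s (f b k) ∈ Submodule.span ℂ D
    rcases hs : s k with _ | c
    · rw [colourProj_apply_of_none hf hs]
      exact zero_mem _
    · rw [colourProj_apply_of_some hf hs]
      exact Submodule.smul_mem _ _ (Submodule.subset_span
        ⟨(c, k), ⟨trivial, by simp [colourSupport, hs], by simp [colourSupport, hb]⟩, rfl⟩)
  exact hle (Submodule.starProjection_apply_mem _ x)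

lemma not_isCompactOperator_colourProj (hf : IsTiltedPair f) (h : (colourSupport s).Infinite) :
    ¬ IsCompactOperator (colourProj f s : H →L[ℂ] H) := by
  intro hK
  have hsmall (b : Bool) : ∀ᶠ k in atTop, ‖colourProj f s (f b k)‖ < 1 := by
    simpa using (hK.tendsto_orthonormal (hf.orthonormal b)).norm.eventually_lt_const
      (by simp : ‖(0 : H)‖ < 1)
  obtain ⟨k, hk, hsmall⟩ := ((Nat.frequently_atTop_iff_infinite.2 h).and_eventually
    (eventually_all.2 hsmall)).exists
  obtain ⟨b, hb⟩ := Option.ne_none_iff_exists'.1 hk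
  refine (hsmall b).ne ?_
  rw [colourProj_apply_of_some hf hb, hf]
  simp [(hf.orthonormal b).1]

/-- Perturbations of the two projections cannot commute if they are small on the plane in which
the projections have different ranges. -/
lemma not_commute_of_colourConflict (hf : IsTiltedPair f) (hst : ColourConflict s t k)
    {A B : H →L[ℂ] H} {M : ℝ} (hA : ‖A‖ ≤ M) (hB : ‖B‖ ≤ M)
    (hAk : ∀ b, ‖(A - colourProj f s) (f b k)‖ ≤ 1 / (16 * (M + 1)))
    (hBk : ∀ b, ‖(B - colourProj f t) (f b k)‖ ≤ 1 / (16 * (M + 1))) :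
    A * B ≠ B * A := by
  intro hcomm
  obtain ⟨b, hs, ht⟩ := hst
  have hM : 0 ≤ M := (norm_nonneg A).trans hA
  set δ : ℝ := 1 / (16 * (M + 1))
  set u := f (!b) k
  set w := f b k
  have huw : inner ℂ u w = 3 / 5 := by simp [u, w, hf (!b) b k k]
  have hwu : inner ℂ w u = 3 / 5 := by simp [u, w, hf b (!b) k k]
  have huu : inner ℂ u u = 1 := by simpa using hf (!b) (!b) k k
  have hww : inner ℂ w w = 1 := by simpa using hf b b k k
  have hsw : colourProj f s w = (3 / 5 : ℂ) • u := by
    rw [colourProj_apply_of_some hf hs, huw]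
  have htw : colourProj f t w = w := by
    rw [colourProj_apply_of_some hf ht, hww, one_smul]
  have htu : colourProj f t u = (3 / 5 : ℂ) • w := by
    rw [colourProj_apply_of_some hf ht, hwu]
  set K := A - colourProj f s
  set L := B - colourProj f t
  have hAw : A w = (3 / 5 : ℂ) • u + K w := by simp [K, hsw]
  have hBw : B w = w + L w := by simp [L, htw]
  have hBu : B u = (3 / 5 : ℂ) • w + L u := by simp [L, htu]
  have hkey : (3 / 5 : ℂ) • u - (9 / 25 : ℂ) • w =
      (3 / 5 : ℂ) • L u + B (K w) - K w - A (L w) := by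
    have h : A (B w) = B (A w) := congrArg (fun T : H →L[ℂ] H ↦ T w) hcomm
    rw [hBw, map_add, hAw, map_add, map_smul, hBu] at h
    have : (3 / 5 : ℂ) • u = (3 / 5 : ℂ) • ((3 / 5 : ℂ) • w + L u) + B (K w) - K w - A (L w) := by
      rw [← h]; abel
    rw [this]
    module
  have hlow : (48 / 125 : ℝ) ≤ ‖(3 / 5 : ℂ) • u - (9 / 25 : ℂ) • w‖ := by
    have h := norm_inner_le_norm (𝕜 := ℂ) u ((3 / 5 : ℂ) • u - (9 / 25 : ℂ) • w)
    rw [inner_sub_right, inner_smul_right, inner_smul_right, huu, huw,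
      (hf.orthonormal (!b)).1 k, one_mul] at h
    norm_num at h ⊢
    exact h
  have hδ : (M + 1) * δ = 1 / 16 := by
    simp only [δ]
    field_simp
  have hBK : ‖B (K w)‖ ≤ M * δ := B.le_of_opNorm_le_of_le hB (hAk b)
  have hAL : ‖A (L w)‖ ≤ M * δ := A.le_of_opNorm_le_of_le hA (hBk b)
  have hLu : ‖(3 / 5 : ℂ) • L u‖ ≤ δ := by
    rw [norm_smul]
    have := hBk (!b)
    have h0 := norm_nonneg (L u)
    norm_num
    linarith
  have hKw : ‖K w‖ ≤ δ := hAk b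
  rw [hkey] at hlow
  have h1 := norm_sub_le ((3 / 5 : ℂ) • L u + B (K w) - K w) (A (L w))
  have h2 := norm_sub_le ((3 / 5 : ℂ) • L u + B (K w)) (K w)
  have h3 := norm_add_le ((3 / 5 : ℂ) • L u) (B (K w))
  linarith

end

/-- There are `ℵ₁` projections on a separable infinite-dimensional Hilbert space whose images
in the Calkin algebra are pairwise orthogonal and pairwise distinct, such that no uncountable
subfamily can be lifted to pairwise commuting bounded operators in `B(H)`. -/
theorem exists_projections_no_uncountable_commuting_lift
    {H : Type*} [NormedAddCommGroup H] [InnerProductSpace ℂ H] [CompleteSpace H]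
    [TopologicalSpace.SeparableSpace H] (hH : ¬ FiniteDimensional ℂ H) :
    ∃ P : {α : Ordinal // α < ω₁} → H →L[ℂ] H,
      (∀ α, IsSelfAdjoint (P α) ∧ IsIdempotentElem (P α)) ∧
      (∀ α, ¬ IsCompactOperator (P α : H →L[ℂ] H)) ∧
      (∀ α β, α ≠ β → IsCompactOperator (P α * P β : H →L[ℂ] H)) ∧
      (∀ α β, α ≠ β → ¬ IsCompactOperator (P α - P β : H →L[ℂ] H)) ∧
      (∀ S : Set {α : Ordinal // α < ω₁}, ¬ S.Countable →
        ¬ ∃ T : {α : Ordinal // α < ω₁} → H →L[ℂ] H,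
          (∀ α ∈ S, ∀ β ∈ S, T α * T β = T β * T α) ∧
          (∀ α ∈ S, IsCompactOperator (T α - P α : H →L[ℂ] H))) := by
  obtain ⟨f, hf⟩ := exists_isTiltedPair hH
  obtain ⟨A, hinf, hfin, hconf⟩ := exists_luzin_colourings countable_Iio_of_lt_omega_one
  refine ⟨fun α ↦ colourProj f (A α), fun α ↦ ⟨isSelfAdjoint_starProjection _,
    Submodule.isIdempotentElem_starProjection _⟩,
    fun α ↦ not_isCompactOperator_colourProj hf (hinf α),
    fun α β h ↦ isCompactOperator_colourProj_mul hf (hfin α β h), fun α β h hK ↦ ?_, ?_⟩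
  · have hidem : colourProj f (A α) * colourProj f (A α) = colourProj f (A α) :=
      Submodule.isIdempotentElem_starProjection _
    refine not_isCompactOperator_colourProj hf (hinf α) ?_
    have h1 : IsCompactOperator
        (colourProj f (A α) * (colourProj f (A α) - colourProj f (A β)) : H →L[ℂ] H) :=
      hK.clm_comp (colourProj f (A α))
    have h2 := h1.add (isCompactOperator_colourProj_mul hf (hfin α β h))
    rw [mul_sub, hidem] at h2
    rwa [← FunLike.coe_add, sub_add_cancel] at h2
  · rintro S hS ⟨T, hcomm, hT⟩
    set S' : ℕ × ℕ → Set {α : Ordinal // α < ω₁} := fun p ↦ {α ∈ S | ‖T α‖ ≤ p.1 ∧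
      ∀ k ≥ p.2, ∀ b, ‖(T α - colourProj f (A α)) (f b k)‖ ≤ 1 / (16 * ((p.1 : ℝ) + 1))}
    have hcover : S ⊆ ⋃ p, S' p := by
      intro α hα
      obtain ⟨M, hM⟩ := exists_nat_ge ‖T α‖
      have hsmall (b : Bool) : ∀ᶠ k in atTop,
          ‖(T α - colourProj f (A α)) (f b k)‖ ≤ 1 / (16 * ((M : ℝ) + 1)) :=
        ((hT α hα).tendsto_orthonormal (hf.orthonormal b)).norm.eventually_le_const
          (by rw [norm_zero]; positivity)
      obtain ⟨N, hN⟩ := eventually_atTop.1 (eventually_all.2 hsmall)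
      exact Set.mem_iUnion.2 ⟨(M, N), hα, hM, hN⟩
    obtain ⟨⟨M, N⟩, hp⟩ : ∃ p, ¬ (S' p).Countable := by
      by_contra! h
      exact hS ((Set.countable_iUnion h).mono hcover)
    obtain ⟨α, hα, hαinf⟩ := exists_infinite_inter_Iio countable_Iio_of_lt_omega_one hp
    obtain ⟨β, ⟨hβ, hβα⟩, hβ'⟩ := (hαinf.sdiff (hconf α N)).nonempty
    obtain ⟨k, hk, hαβ⟩ : ∃ k ≥ N, ColourConflict (A α) (A β) k := by
      by_contra! h
      exact hβ' ⟨hβα, h⟩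
    exact not_commute_of_colourConflict hf hαβ hα.2.1 hβ.2.1 (hα.2.2 k hk) (hβ.2.2 k hk)
      (hcomm α hα.1 β hβ.1)
end

section
/- Let H be a separable infinite-dimensional complex Hilbert space. There exists a family (P_α)_{α<ω₁} of projections in B(H), none of which is compact, such that P_α P_β is compact and P_α − P_β is not compact for all distinct α, β < ω₁, and such that for every commutative C*-subalgebra A of B(H), the set {α < ω₁ : there exists a ∈ A with P_α − a compact} is countable. -/
open scoped Ordinal

/-- Along a well-order, a function can be built from its values at smaller indices. -/
lemma exists_forall_eq_image_Iio {ι β : Type*} [LinearOrder ι] [WellFoundedLT ι]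
    (step : ι → Set β → β) : ∃ f : ι → β, ∀ i, f i = step i (f '' Set.Iio i) := by
  refine ⟨WellFounded.fix (wellFounded_lt (α := ι))
    fun i g => step i (Set.range fun j : Set.Iio i => g j j.2), fun i => ?_⟩
  rw [WellFounded.fix_eq, Set.image_eq_range]

/-- A set each of whose elements has only finitely many predecessors in it is countable. -/
lemma Set.countable_of_forall_finite_inter_Iio {ι : Type*} [LinearOrder ι] (X : Set ι)
    (hX : ∀ i ∈ X, (X ∩ Set.Iio i).Finite) : X.Countable := by
  have h : X.InjOn fun i => (X ∩ Set.Iio i).ncard := by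
    have : StrictMonoOn (fun i => (X ∩ Set.Iio i).ncard) X := fun i hi j hj hij => by
      refine Set.ncard_lt_ncard ⟨fun k hk => ⟨hk.1, hk.2.trans hij⟩, fun hs => ?_⟩ (hX j hj)
      exact lt_irrefl _ (hs ⟨hi, hij⟩).2
    exact this.injOn
  exact (Set.mapsTo_univ _ _).countable_of_injOn h (Set.to_countable _)

section Hilbert

open ContinuousLinearMap
open scoped InnerProductSpace

variable {H : Type*} [NormedAddCommGroup H] [InnerProductSpace ℂ H]

/-- An infinite-dimensional subspace contains a unit vector orthogonal to a given finite set. -/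
lemma Submodule.exists_norm_eq_one_of_not_finiteDimensional (V : Submodule ℂ H)
    (hV : ¬ FiniteDimensional ℂ V) {T : Set H} (hT : T.Finite) :
    ∃ w ∈ V, ‖w‖ = 1 ∧ ∀ t ∈ T, ⟪t, w⟫_ℂ = 0 := by
  classical
  have := hT.to_subtype
  let F : V →ₗ[ℂ] (T → ℂ) :=
    LinearMap.pi fun t => (innerSL ℂ (t : H)).toLinearMap ∘ₗ V.subtype
  have hF : ¬ Function.Injective F := fun h => hV (FiniteDimensional.of_injective F h)
  rw [← LinearMap.ker_eq_bot, Submodule.eq_bot_iff] at hF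
  push Not at hF
  obtain ⟨v, hv, hv0⟩ := hF
  have hv0' : (v : H) ≠ 0 := by simpa using hv0
  refine ⟨((‖(v : H)‖⁻¹ : ℝ) : ℂ) • (v : H), V.smul_mem _ v.2, ?_, fun t ht => ?_⟩
  · rw [norm_smul]
    simp [hv0']
  · have : ⟪t, (v : H)⟫_ℂ = 0 := congrFun (LinearMap.mem_ker.1 hv) ⟨t, ht⟩
    rw [inner_smul_right, this, mul_zero]

/-- A compact operator fixes only a finite-dimensional space of vectors. -/
lemma IsCompactOperator.not_of_linearIndependent [CompleteSpace H] {P : H →L[ℂ] H} {a : ℕ → H}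
    (ha : LinearIndependent ℂ a) (hP : ∀ n, P (a n) = a n) : ¬ IsCompactOperator P := by
  intro hc
  have := finite_dimensional_eigenspace hc 1 one_ne_zero
  have hmem : ∀ n, a n ∈ Module.End.eigenspace (P : H →ₗ[ℂ] H) 1 := fun n => by
    simp [hP]
  have hli : LinearIndependent ℂ fun n =>
      (⟨a n, hmem n⟩ : Module.End.eigenspace (P : H →ₗ[ℂ] H) 1) :=
    LinearIndependent.of_comp (Submodule.subtype _) ha
  exact not_finite_iff_infinite.2 inferInstance hli.finite

lemma IsCompactOperator.of_finiteDimensional_range {P : H →L[ℂ] H}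
    (h : FiniteDimensional ℂ (P : H →ₗ[ℂ] H).range) : IsCompactOperator P := by
  have h1 : IsCompactOperator (P.codRestrict (P : H →ₗ[ℂ] H).range fun x => ⟨x, rfl⟩) :=
    isCompactOperator_of_locallyCompactSpace_dom _
  exact h1.clm_comp (Submodule.subtypeL _)

lemma isCompactOperator_rankOne (x y : H) :
    IsCompactOperator (InnerProductSpace.rankOne ℂ x y) := by
  have h1 : IsCompactOperator (innerSL ℂ y) :=
    isCompactOperator_of_locallyCompactSpace_dom _
  exact h1.clm_comp (toSpanSingleton ℂ x)

lemma IsCompactOperator.of_hasSum [CompleteSpace H] {f : ℕ → H →L[ℂ] H} {S : H →L[ℂ] H}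
    (hf : ∀ n, IsCompactOperator (f n)) (h : HasSum f S) : IsCompactOperator S := by
  refine isCompactOperator_of_tendsto h (Filter.Eventually.of_forall fun s => ?_)
  have : ∑ n ∈ s, f n ∈ compactOperator (RingHom.id ℂ) H H :=
    Submodule.sum_mem _ fun n _ => hf n
  exact this

/-- The commutator of `P` and `Q` has norm at least `1 / 4` when compressed to the orthogonal
complement of the first `n` terms of `d`. -/
def LargeCommutator (d : ℕ → H) (n : ℕ) (P Q : H →L[ℂ] H) : Prop :=
  ∃ x y : H, ‖x‖ = 1 ∧ ‖y‖ = 1 ∧ (∀ i < n, ⟪d i, x⟫_ℂ = 0) ∧ (∀ i < n, ⟪d i, y⟫_ℂ = 0) ∧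
    1 / 4 ≤ ‖⟪x, (P * Q - Q * P) y⟫_ℂ‖

lemma LargeCommutator.mono {d : ℕ → H} {m n : ℕ} {P Q : H →L[ℂ] H} (hmn : m ≤ n)
    (h : LargeCommutator d n P Q) : LargeCommutator d m P Q := by
  obtain ⟨x, y, hx, hy, hxd, hyd, h⟩ := h
  exact ⟨x, y, hx, hy, fun i hi => hxd i (hi.trans_le hmn), fun i hi => hyd i (hi.trans_le hmn), h⟩

variable [CompleteSpace H]

/-- If `K† K` is compact, then `K` is small on the orthogonal complement of finitely many
vectors of a dense sequence. -/
lemma exists_norm_apply_le_of_isCompactOperator_adjoint_mul {d : ℕ → H} (hd : DenseRange d)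
    {K : H →L[ℂ] H} (hK : IsCompactOperator fun x => adjoint K (K x)) {ε : ℝ} (hε : 0 < ε) :
    ∃ n, ∀ x : H, ‖x‖ = 1 → (∀ i < n, ⟪d i, x⟫_ℂ = 0) → ‖K x‖ ≤ ε := by
  obtain ⟨C, hC, hsub⟩ := IsCompactOperator.image_closedBall_subset_compact
    (f := ((adjoint K * K : H →L[ℂ] H) : H →ₗ[ℂ] H)) hK 1
  obtain ⟨t, ht⟩ := hC.elim_finite_subcover (fun i => Metric.ball (d i) (ε ^ 2))
    (fun _ => Metric.isOpen_ball) fun y _ => by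
      obtain ⟨i, hi⟩ := hd.exists_dist_lt y (pow_pos hε 2)
      exact Set.mem_iUnion.2 ⟨i, hi⟩
  refine ⟨t.sup id + 1, fun x hx hxd => ?_⟩
  have hmem := ht (hsub ⟨x, by simp [hx], rfl⟩)
  simp only [Set.mem_iUnion] at hmem
  obtain ⟨i, hi, hdi⟩ := hmem
  have h0 := hxd i (Nat.lt_succ_of_le (Finset.le_sup (f := id) hi))
  have h1 : ((‖K x‖ ^ 2 : ℝ) : ℂ) = ⟪adjoint K (K x) - d i, x⟫_ℂ := by
    rw [inner_sub_left, h0, sub_zero, adjoint_inner_left]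
    simp [inner_self_eq_norm_sq_to_K]
  have h2 : ‖K x‖ ^ 2 ≤ ε ^ 2 := by
    have := norm_inner_le_norm (𝕜 := ℂ) (adjoint K (K x) - d i) x
    rw [← h1, hx, mul_one, Complex.norm_real, Real.norm_of_nonneg (by positivity)] at this
    rw [Metric.mem_ball, dist_eq_norm] at hdi
    exact this.trans hdi.le
  exact le_of_sq_le_sq h2 hε.le

lemma IsCompactOperator.exists_norm_apply_le {d : ℕ → H} (hd : DenseRange d)
    {K : H →L[ℂ] H} (hK : IsCompactOperator K) {ε : ℝ} (hε : 0 < ε) :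
    ∃ n, ∀ x : H, ‖x‖ = 1 → (∀ i < n, ⟪d i, x⟫_ℂ = 0) → ‖K x‖ ≤ ε ∧ ‖adjoint K x‖ ≤ ε := by
  obtain ⟨n, hn⟩ := exists_norm_apply_le_of_isCompactOperator_adjoint_mul hd
    (hK.clm_comp (adjoint K)) hε
  obtain ⟨m, hm⟩ := exists_norm_apply_le_of_isCompactOperator_adjoint_mul hd
    (K := adjoint K) (by
      rw [adjoint_adjoint]
      exact hK.comp_clm (adjoint K)) hε
  exact ⟨max n m, fun x hx h => ⟨hn x hx fun i hi => h i (lt_max_of_lt_left hi),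
    hm x hx fun i hi => h i (lt_max_of_lt_right hi)⟩⟩

lemma IsStarProjection.norm_apply_le {P : H →L[ℂ] H} (hP : IsStarProjection P) (x : H) :
    ‖P x‖ ≤ ‖x‖ :=
  (P.le_of_opNorm_le hP.norm_le x).trans_eq (one_mul _)

/-- Operators uniformly close to commuting ones on a subspace have small commutator there. -/
lemma not_largeCommutator {d : ℕ → H} {n : ℕ} {P Q a b : H →L[ℂ] H}
    (hP : IsStarProjection P) (hQ : IsStarProjection Q) (hab : a * b = b * a)
    (ha : ∀ x : H, ‖x‖ = 1 → (∀ i < n, ⟪d i, x⟫_ℂ = 0) →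
      ‖(P - a) x‖ ≤ 1 / 20 ∧ ‖adjoint (P - a) x‖ ≤ 1 / 20)
    (hb : ∀ x : H, ‖x‖ = 1 → (∀ i < n, ⟪d i, x⟫_ℂ = 0) →
      ‖(Q - b) x‖ ≤ 1 / 20 ∧ ‖adjoint (Q - b) x‖ ≤ 1 / 20) :
    ¬ LargeCommutator d n P Q := by
  rintro ⟨x, y, hx, hy, hxd, hyd, h⟩
  have key : ∀ {P Q a b : H →L[ℂ] H}, IsStarProjection P → IsStarProjection Q →
      ‖adjoint (P - a) x‖ ≤ 1 / 20 → ‖(Q - b) y‖ ≤ 1 / 20 →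
      ‖⟪x, (P * Q - a * b) y⟫_ℂ‖ ≤ 41 / 400 := by
    intro P Q a b hP hQ h1 h2
    have e : ⟪x, (P * Q - a * b) y⟫_ℂ =
        ⟪adjoint (P - a) x, Q y⟫_ℂ + ⟪P x - adjoint (P - a) x, (Q - b) y⟫_ℂ := by
      have hPa : adjoint P = P := hP.isSelfAdjoint
      have : P x - adjoint (P - a) x = adjoint a x := by simp [hPa]
      rw [this, adjoint_inner_left, adjoint_inner_left, ← inner_add_right]
      congr 1
      simp
    have hQy := hQ.norm_apply_le y
    have hPx := hP.norm_apply_le x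
    rw [hy] at hQy
    rw [hx] at hPx
    have h3 : ‖P x - adjoint (P - a) x‖ ≤ 1 + 1 / 20 := (norm_sub_le _ _).trans (add_le_add hPx h1)
    rw [e]
    calc _ ≤ _ := norm_add_le _ _
      _ ≤ ‖adjoint (P - a) x‖ * ‖Q y‖ + ‖P x - adjoint (P - a) x‖ * ‖(Q - b) y‖ :=
        add_le_add (norm_inner_le_norm _ _) (norm_inner_le_norm _ _)
      _ ≤ 1 / 20 * 1 + (1 + 1 / 20) * (1 / 20) := by gcongr
      _ = 41 / 400 := by norm_num
  have k1 := key hP hQ (ha x hx hxd).2 (hb y hy hyd).1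
  have k2 := key hQ hP (hb x hx hxd).2 (ha y hy hyd).1
  have e : (P * Q - Q * P) y = (P * Q - a * b) y - (Q * P - b * a) y := by
    rw [hab, ← sub_apply]
    congr 1
    abel
  rw [e, inner_sub_right] at h
  have := norm_sub_le (⟪x, (P * Q - a * b) y⟫_ℂ) (⟪x, (Q * P - b * a) y⟫_ℂ)
  linarith

lemma exists_orthogonal_starProjections (hH : ¬ FiniteDimensional ℂ H) :
    ∃ E : ℕ → H →L[ℂ] H, (∀ n, IsStarProjection (E n)) ∧ (∀ n, ¬ IsCompactOperator (E n)) ∧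
      ∀ m n, m ≠ n → E m * E n = 0 := by
  obtain ⟨b, hb1, hb2⟩ := exists_seq_of_forall_finset_exists (fun x : H => ‖x‖ = 1)
    (fun x y => ⟪x, y⟫_ℂ = 0) fun s _ => by
      obtain ⟨w, -, hw, hws⟩ := (⊤ : Submodule ℂ H).exists_norm_eq_one_of_not_finiteDimensional
        (fun h => hH (Module.Finite.equiv (Submodule.topEquiv (R := ℂ) (M := H)))) s.finite_toSet
      exact ⟨w, hw, hws⟩
  have horth : ∀ i j, i ≠ j → ⟪b i, b j⟫_ℂ = 0 := fun i j hij => by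
    rcases hij.lt_or_gt with h | h
    · exact hb2 i j h
    · exact inner_eq_zero_symm.1 (hb2 j i h)
  have hbo : Orthonormal ℂ b := ⟨hb1, fun i j hij => horth i j hij⟩
  let V : ℕ → Submodule ℂ H := fun n =>
    (Submodule.span ℂ (Set.range fun k => b (Nat.pair n k))).topologicalClosure
  have hV : ∀ n, CompleteSpace (V n) := fun n =>
    (Submodule.isClosed_topologicalClosure _).completeSpace_coe
  refine ⟨fun n => (V n).starProjection, fun n => isStarProjection_starProjection,
    fun n => ?_, fun m n hmn => ?_⟩
  · refine IsCompactOperator.not_of_linearIndependent (a := fun k => b (Nat.pair n k))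
      (hbo.linearIndependent.comp _ fun k l h => (Nat.pair_eq_pair.1 h).2) fun k => ?_
    exact Submodule.starProjection_eq_self_iff.2
      (Submodule.le_topologicalClosure _ (Submodule.subset_span ⟨k, rfl⟩))
  · refine Submodule.IsOrtho.starProjection_comp_starProjection ?_
    simp only [V, Submodule.IsOrtho, Submodule.orthogonal_closure]
    refine Submodule.topologicalClosure_minimal _ ?_ (Submodule.isClosed_orthogonal _)
    refine Submodule.isOrtho_span.2 ?_
    rintro _ ⟨k, rfl⟩ _ ⟨l, rfl⟩
    exact horth _ _ fun h => hmn (Nat.pair_eq_pair.1 h).1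

lemma exists_unit_vector_in_range {d : ℕ → H} (hd : DenseRange d) {Q : ℕ → H →L[ℂ] H}
    (hQ : ∀ n, IsStarProjection (Q n)) (hc : ∀ n, ¬ IsCompactOperator (Q n))
    (ho : ∀ m n, m ≠ n → IsCompactOperator (Q m * Q n : H →L[ℂ] H)) (g N : ℕ) {ε : ℝ}
    (hε : 0 < ε) {T : Set H} (hT : T.Finite) :
    ∃ w, ‖w‖ = 1 ∧ Q g w = w ∧ (∀ t ∈ T, ⟪t, w⟫_ℂ = 0) ∧ (∀ i < N, ⟪d i, w⟫_ℂ = 0) ∧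
      ∀ m < g, ‖Q m w‖ ≤ ε := by
  have h1 : ∀ m, ∃ n, m < g → ∀ x : H, ‖x‖ = 1 → (∀ i < n, ⟪d i, x⟫_ℂ = 0) →
      ‖(Q m * Q g) x‖ ≤ ε := fun m => by
    by_cases hm : m < g
    · obtain ⟨n, hn⟩ := (ho m g hm.ne).exists_norm_apply_le hd hε
      exact ⟨n, fun _ x hx h => (hn x hx h).1⟩
    · exact ⟨0, fun h => absurd h hm⟩
  choose n hn using h1
  let M := N + (Finset.range g).sup n
  obtain ⟨w, ⟨v, rfl⟩, hw, hwT⟩ :=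
    ((Q g : H →ₗ[ℂ] H).range).exists_norm_eq_one_of_not_finiteDimensional
      (fun h => hc g (.of_finiteDimensional_range h)) (hT.union ((Set.finite_Iio M).image d))
  have hfix : Q g (Q g v) = Q g v := congrArg (fun S : H →L[ℂ] H => S v) (hQ g).isIdempotentElem
  have hwd : ∀ i < M, ⟪d i, Q g v⟫_ℂ = 0 := fun i hi => hwT _ (Or.inr ⟨i, hi, rfl⟩)
  refine ⟨Q g v, hw, hfix, fun t ht => hwT t (Or.inl ht), fun i hi => hwd i (by omega),
    fun m hm => ?_⟩
  have := hn m hm (Q g v) hw fun i hi => hwd i <| hi.trans_le <|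
    (Finset.le_sup (f := n) (Finset.mem_range.2 hm)).trans (Nat.le_add_left _ _)
  rwa [mul_apply_eq_comp, hfix] at this

/-- If `P` is the projection onto the closed span of the `a n`, which are orthogonal of norm
`√2`, then `Q P` and `P Q` are compact as soon as `‖Q (a n)‖` is summable. -/
lemma isCompactOperator_mul_starProjection {a : ℕ → H} (ha : ∀ n, ⟪a n, a n⟫_ℂ = 2)
    (hort : ∀ m n, m ≠ n → ⟪a m, a n⟫_ℂ = 0) {P Q : H →L[ℂ] H} (hP : IsStarProjection P)
    (hQ : IsStarProjection Q) (hPa : ∀ n, P (a n) = a n)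
    (hPeq : ∀ T : H →L[ℂ] H, (∀ n, T (a n) = 0) → T * P = 0)
    (hsum : Summable fun n => ‖Q (a n)‖) :
    IsCompactOperator (Q * P : H →L[ℂ] H) ∧ IsCompactOperator (P * Q : H →L[ℂ] H) := by
  have hPadj : adjoint P = P := hP.isSelfAdjoint
  let f : ℕ → H →L[ℂ] H := fun n => (2⁻¹ : ℂ) • InnerProductSpace.rankOne ℂ (Q (a n)) (a n)
  have hfc : ∀ n, IsCompactOperator (f n) := fun n => (isCompactOperator_rankOne _ _).smul _
  have hsq : ∀ n, (‖a n‖ : ℂ) ^ 2 = 2 := fun n => by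
    rw [← ha n, inner_self_eq_norm_sq_to_K]
    rfl
  have hnorm : ∀ n, ‖a n‖ ≤ 2 := fun n => by
    have h : ‖a n‖ ^ 2 = 2 := by exact_mod_cast hsq n
    nlinarith [norm_nonneg (a n)]
  have hf : Summable f := by
    refine Summable.of_norm_bounded hsum fun n => ?_
    have := hnorm n
    simp only [f, norm_smul, InnerProductSpace.norm_rankOne]
    norm_num
    nlinarith [norm_nonneg (Q (a n))]
  obtain ⟨S, hS⟩ := hf
  have hfP : ∀ n, f n * P = f n := fun n => by
    ext x
    have : ⟪a n, P x⟫_ℂ = ⟪a n, x⟫_ℂ := by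
      rw [← adjoint_inner_left, hPadj, hPa]
    simp [f, this]
  have hSP : S * P = S := by
    have := hS.mul_right P
    simp only [hfP] at this
    exact this.unique hS
  have hSa : ∀ n, S (a n) = Q (a n) := fun n => by
    have h1 : HasSum (fun m => f m (a n)) (S (a n)) :=
      hS.mapL (ContinuousLinearMap.apply ℂ H (a n))
    have h2 : HasSum (fun m => f m (a n)) (f n (a n)) := hasSum_single n fun m hm => by
      simp [f, hort m n hm]
    rw [h1.unique h2]
    simp [f, hsq, smul_smul]
  have hSQ : S = Q * P := by
    have := hPeq (S - Q) fun n => by simp [hSa]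
    rwa [sub_mul, hSP, sub_eq_zero] at this
  refine ⟨hSQ ▸ .of_hasSum hfc hS, ?_⟩
  have h3 : HasSum (fun n => star (f n)) (P * Q) := by
    have := hS.star
    rwa [hSQ, star_mul, hP.isSelfAdjoint.star_eq, hQ.isSelfAdjoint.star_eq] at this
  refine .of_hasSum (fun n => ?_) h3
  have : star (f n) = (2⁻¹ : ℂ) • InnerProductSpace.rankOne ℂ (a n) (Q (a n)) := by
    rw [star_smul, star_eq_adjoint, InnerProductSpace.adjoint_rankOne]
    simp
  rw [this]
  exact (isCompactOperator_rankOne _ _).smul _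

lemma exists_starProjection_of_sequence {d : ℕ → H} (hd : DenseRange d) {Q : ℕ → H →L[ℂ] H}
    (hQ : ∀ n, IsStarProjection (Q n)) (hc : ∀ n, ¬ IsCompactOperator (Q n))
    (ho : ∀ m n, m ≠ n → IsCompactOperator (Q m * Q n : H →L[ℂ] H)) :
    ∃ P : H →L[ℂ] H, IsStarProjection P ∧ ¬ IsCompactOperator P ∧
      (∀ n, IsCompactOperator (Q n * P : H →L[ℂ] H) ∧ IsCompactOperator (P * Q n : H →L[ℂ] H)) ∧
      ∀ n, LargeCommutator d n P (Q n) := by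
  have ex : ∀ (k : ℕ) (T : Set H), T.Finite → ∃ w, ‖w‖ = 1 ∧ Q ((k + 1) / 2) w = w ∧
      (∀ t ∈ T, ⟪t, w⟫_ℂ = 0) ∧ (∀ i < k, ⟪d i, w⟫_ℂ = 0) ∧
      ∀ m < (k + 1) / 2, ‖Q m w‖ ≤ 1 / 4 * (1 / 2) ^ k := fun k T hT =>
    exists_unit_vector_in_range hd hQ hc ho _ _ (by positivity) hT
  choose! step hstep using ex
  obtain ⟨z, hz⟩ := exists_forall_eq_image_Iio step
  have hz' := fun k => hstep k (z '' Set.Iio k) ((Set.finite_Iio k).image z)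
  simp only [← hz] at hz'
  have hz1 : ∀ k, ‖z k‖ = 1 := fun k => (hz' k).1
  have hz2 : ∀ k, Q ((k + 1) / 2) (z k) = z k := fun k => (hz' k).2.1
  have hzd : ∀ k, ∀ i < k, ⟪d i, z k⟫_ℂ = 0 := fun k => (hz' k).2.2.2.1
  have hzs : ∀ k, ∀ m < (k + 1) / 2, ‖Q m (z k)‖ ≤ 1 / 4 * (1 / 2) ^ k :=
    fun k => (hz' k).2.2.2.2
  have hzo : ∀ k l, k ≠ l → ⟪z k, z l⟫_ℂ = 0 := fun k l hkl => by
    rcases hkl.lt_or_gt with h | h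
    · exact (hz' l).2.2.1 _ ⟨k, h, rfl⟩
    · exact inner_eq_zero_symm.1 ((hz' k).2.2.1 _ ⟨l, h, rfl⟩)
  have hzz : ∀ k, ⟪z k, z k⟫_ℂ = 1 := fun k => by simp [inner_self_eq_norm_sq_to_K, hz1]
  let a : ℕ → H := fun n => z (2 * n) + z (2 * n + 1)
  have hza : ∀ n, ⟪z (2 * n), a n⟫_ℂ = 1 := fun n => by
    rw [inner_add_right, hzz, hzo _ _ (by omega), add_zero]
  have ha : ∀ n, ⟪a n, a n⟫_ℂ = 2 := fun n => by
    rw [inner_add_left, hza, inner_add_right, hzz, hzo _ _ (by omega)]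
    norm_num
  have hort : ∀ m n, m ≠ n → ⟪a m, a n⟫_ℂ = 0 := fun m n hmn => by
    simp only [a, inner_add_left, inner_add_right]
    rw [hzo _ _ (by omega), hzo _ _ (by omega), hzo _ _ (by omega), hzo _ _ (by omega)]
    simp
  let V : Submodule ℂ H := (Submodule.span ℂ (Set.range a)).topologicalClosure
  have hV : CompleteSpace V := (Submodule.isClosed_topologicalClosure _).completeSpace_coe
  have hP : IsStarProjection V.starProjection := isStarProjection_starProjection
  have hPa : ∀ n, V.starProjection (a n) = a n := fun n => Submodule.starProjection_eq_self_iff.2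
    (Submodule.le_topologicalClosure _ (Submodule.subset_span ⟨n, rfl⟩))
  have hPeq : ∀ T : H →L[ℂ] H, (∀ n, T (a n) = 0) → T * V.starProjection = 0 := by
    intro T hT
    have hle : V ≤ (T : H →ₗ[ℂ] H).ker := by
      refine Submodule.topologicalClosure_minimal _ (Submodule.span_le.2 ?_) T.isClosed_ker
      rintro _ ⟨n, rfl⟩
      exact hT n
    ext x
    exact hle (V.starProjection_apply_mem x)
  have hPadj : adjoint V.starProjection = V.starProjection := hP.isSelfAdjoint
  have hPy : ∀ n, V.starProjection (z (2 * n + 1)) = (2⁻¹ : ℂ) • a n := fun n => by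
    have h0 : V.starProjection (z (2 * n + 1) - (2⁻¹ : ℂ) • a n) = 0 := by
      rw [Submodule.starProjection_apply_eq_zero_iff, Submodule.orthogonal_closure]
      refine (Submodule.mem_orthogonal _ _).2 fun u hu => ?_
      induction hu using Submodule.span_induction with
      | mem u hu =>
        obtain ⟨m, rfl⟩ := hu
        rw [inner_sub_right, inner_smul_right]
        rcases eq_or_ne m n with rfl | hmn
        · rw [ha, inner_add_left, hzz, hzo _ _ (by omega)]
          norm_num
        · rw [hort m n hmn, inner_add_left, hzo _ _ (by omega), hzo _ _ (by omega)]
          simp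
      | zero => simp
      | add u v _ _ hu hv => rw [inner_add_left, hu, hv, add_zero]
      | smul c u _ hu => rw [inner_smul_left, hu, mul_zero]
    rw [map_sub, map_smul, hPa, sub_eq_zero] at h0
    exact h0
  refine ⟨V.starProjection, hP, ?_, fun n => ?_, fun n => ?_⟩
  · refine IsCompactOperator.not_of_linearIndependent (a := a)
      (linearIndependent_of_ne_zero_of_inner_eq_zero (𝕜 := ℂ) (fun n h => ?_)
        fun m n hmn => hort m n hmn) hPa
    have := ha n
    simp [h] at this
  · refine isCompactOperator_mul_starProjection ha hort hP (hQ n) hPa hPeq ?_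
    refine Summable.of_norm_bounded_eventually_nat
      (summable_geometric_of_lt_one (r := (1 / 2 : ℝ)) (by norm_num) (by norm_num)) ?_
    filter_upwards [Filter.eventually_gt_atTop n] with k hk
    rw [norm_norm, map_add]
    have h1 := hzs (2 * k) n (by omega)
    have h2 := hzs (2 * k + 1) n (by omega)
    have h3 : (1 / 2 : ℝ) ^ (2 * k) ≤ (1 / 2) ^ k :=
      pow_le_pow_of_le_one (by norm_num) (by norm_num) (by omega)
    have h4 : (1 / 2 : ℝ) ^ (2 * k + 1) ≤ (1 / 2) ^ k :=
      pow_le_pow_of_le_one (by norm_num) (by norm_num) (by omega)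
    have h5 : (0 : ℝ) ≤ (1 / 2) ^ k := by positivity
    linarith [norm_add_le (Q n (z (2 * k))) (Q n (z (2 * k + 1)))]
  · refine ⟨z (2 * n), z (2 * n + 1), hz1 _, hz1 _, fun i hi => hzd _ i (by omega),
      fun i hi => hzd _ i (by omega), ?_⟩
    have hQadj : adjoint (Q n) = Q n := (hQ n).isSelfAdjoint
    have hQx : Q n (z (2 * n)) = z (2 * n) := by
      have := hz2 (2 * n)
      rwa [show (2 * n + 1) / 2 = n by omega] at this
    have h1 : ⟪z (2 * n), (Q n) (V.starProjection (z (2 * n + 1)))⟫_ℂ = 2⁻¹ := by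
      rw [← adjoint_inner_left, hQadj, hQx, hPy, inner_smul_right, hza, mul_one]
    have h2 : ‖⟪z (2 * n), V.starProjection (Q n (z (2 * n + 1)))⟫_ℂ‖ ≤ 1 / 4 := by
      refine (norm_inner_le_norm _ _).trans ?_
      rw [hz1, one_mul]
      refine (hP.norm_apply_le _).trans ((hzs _ n (by omega)).trans ?_)
      have : (1 / 2 : ℝ) ^ (2 * n + 1) ≤ 1 := pow_le_one₀ (by norm_num) (by norm_num)
      linarith
    rw [sub_apply, mul_apply_eq_comp, mul_apply_eq_comp, inner_sub_right, h1, norm_sub_rev]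
    have h3 := norm_sub_norm_le (2⁻¹ : ℂ) ⟪z (2 * n), V.starProjection (Q n (z (2 * n + 1)))⟫_ℂ
    have h4 : ‖(2⁻¹ : ℂ)‖ = 1 / 2 := by norm_num
    linarith

lemma exists_starProjection_of_countable {d : ℕ → H} (hd : DenseRange d) {S : Set (H →L[ℂ] H)}
    (hS : S.Countable) (hSinf : S.Infinite) (hQ : ∀ Q ∈ S, IsStarProjection Q)
    (hc : ∀ Q ∈ S, ¬ IsCompactOperator Q)
    (ho : ∀ Q ∈ S, ∀ R ∈ S, Q ≠ R → IsCompactOperator (Q * R : H →L[ℂ] H)) :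
    ∃ P : H →L[ℂ] H, IsStarProjection P ∧ ¬ IsCompactOperator P ∧
      (∀ Q ∈ S, IsCompactOperator (Q * P : H →L[ℂ] H) ∧
        IsCompactOperator (P * Q : H →L[ℂ] H)) ∧
      ∀ n, {Q ∈ S | ¬ LargeCommutator d n P Q}.Finite := by
  have := hS.to_subtype
  have := hSinf.to_subtype
  obtain ⟨e⟩ := nonempty_equiv_of_countable (α := ℕ) (β := S)
  obtain ⟨P, hP, hPc, hPQ, hL⟩ := exists_starProjection_of_sequence hd
    (Q := fun n => (e n : H →L[ℂ] H)) (fun n => hQ _ (e n).2) (fun n => hc _ (e n).2)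
    fun m n hmn => ho _ (e m).2 _ (e n).2 fun h => hmn (e.injective (Subtype.ext h))
  refine ⟨P, hP, hPc, fun Q hQ => ?_, fun n => ?_⟩
  · obtain ⟨m, hm⟩ := e.surjective ⟨Q, hQ⟩
    have := hPQ m
    rwa [hm] at this
  · refine ((Set.finite_Iio n).image fun m => (e m : H →L[ℂ] H)).subset ?_
    rintro Q ⟨hQ, hQn⟩
    obtain ⟨m, hm⟩ := e.surjective ⟨Q, hQ⟩
    refine ⟨m, ?_, by simp [hm]⟩
    by_contra h
    have h1 := (hL m).mono (not_lt.1 h)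
    rw [hm] at h1
    exact hQn h1

/-- A transfinite family of almost orthogonal projections, each having a large commutator with
all but finitely many of its predecessors. -/
lemma exists_family {ι : Type*} [LinearOrder ι] [WellFoundedLT ι]
    (hι : ∀ i : ι, (Set.Iio i).Countable) {d : ℕ → H} (hd : DenseRange d)
    (hH : ¬ FiniteDimensional ℂ H) :
    ∃ P : ι → H →L[ℂ] H, (∀ i, IsStarProjection (P i)) ∧ (∀ i, ¬ IsCompactOperator (P i)) ∧
      (∀ i j, i ≠ j → IsCompactOperator (P i * P j : H →L[ℂ] H)) ∧
      ∀ i n, {j | j < i ∧ ¬ LargeCommutator d n (P i) (P j)}.Finite := by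
  obtain ⟨E, hE, hEc, hEo⟩ := exists_orthogonal_starProjections hH
  have hEinj : Function.Injective E := fun m n h => by
    by_contra hmn
    have h1 := hEo m n hmn
    rw [← h, (hE m).isIdempotentElem] at h1
    exact hEc m (h1 ▸ isCompactOperator_zero)
  let Good : Set (H →L[ℂ] H) → Prop := fun S => S.Countable ∧ S.Infinite ∧
    (∀ Q ∈ S, IsStarProjection Q) ∧ (∀ Q ∈ S, ¬ IsCompactOperator Q) ∧
    ∀ Q ∈ S, ∀ R ∈ S, Q ≠ R → IsCompactOperator (Q * R : H →L[ℂ] H)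
  have ex : ∀ S, Good S → ∃ P : H →L[ℂ] H, IsStarProjection P ∧ ¬ IsCompactOperator P ∧
      (∀ Q ∈ S, IsCompactOperator (Q * P : H →L[ℂ] H) ∧
        IsCompactOperator (P * Q : H →L[ℂ] H)) ∧
      ∀ n, {Q ∈ S | ¬ LargeCommutator d n P Q}.Finite := fun S ⟨h1, h2, h3, h4, h5⟩ =>
    exists_starProjection_of_countable hd h1 h2 h3 h4 h5
  choose! step hstep using ex
  obtain ⟨P, hP⟩ := exists_forall_eq_image_Iio (ι := ι) fun _ S => step (Set.range E ∪ S)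
  have hgood : ∀ i, Good (Set.range E ∪ P '' Set.Iio i) := by
    intro i
    induction i using WellFoundedLT.induction with
    | ind i ih =>
    have hs := fun j (hj : j < i) => hstep _ (ih j hj)
    simp only [← hP] at hs
    refine ⟨(Set.countable_range E).union ((hι i).image P),
      (Set.infinite_range_of_injective hEinj).mono Set.subset_union_left, ?_, ?_, ?_⟩
    · rintro _ (⟨n, rfl⟩ | ⟨j, hj, rfl⟩)
      exacts [hE n, (hs j hj).1]
    · rintro _ (⟨n, rfl⟩ | ⟨j, hj, rfl⟩)
      exacts [hEc n, (hs j hj).2.1]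
    · rintro _ (⟨m, rfl⟩ | ⟨j, hj, rfl⟩) _ (⟨n, rfl⟩ | ⟨k, hk, rfl⟩) hne
      · rw [hEo m n fun h => hne (h ▸ rfl)]
        exact isCompactOperator_zero
      · exact ((hs k hk).2.2.1 _ (Or.inl ⟨m, rfl⟩)).1
      · exact ((hs j hj).2.2.1 _ (Or.inl ⟨n, rfl⟩)).2
      · rcases lt_trichotomy j k with h | rfl | h
        · exact ((hs k hk).2.2.1 _ (Or.inr ⟨j, h, rfl⟩)).1
        · exact absurd rfl hne
        · exact ((hs j hj).2.2.1 _ (Or.inr ⟨k, h, rfl⟩)).2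
  have hs := fun i => hstep _ (hgood i)
  simp only [← hP] at hs
  have ho : ∀ i j, i ≠ j → IsCompactOperator (P i * P j : H →L[ℂ] H) := fun i j hij => by
    rcases hij.lt_or_gt with h | h
    · exact ((hs j).2.2.1 _ (Or.inr ⟨i, h, rfl⟩)).1
    · exact ((hs i).2.2.1 _ (Or.inr ⟨j, h, rfl⟩)).2
  have hinj : Function.Injective P := fun i j h => by
    by_contra hij
    have h1 := ho i j hij
    rw [← h, (hs i).1.isIdempotentElem] at h1
    exact (hs i).2.1 h1
  refine ⟨P, fun i => (hs i).1, fun i => (hs i).2.1, ho, fun i n => ?_⟩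
  refine Set.Finite.of_finite_image (((hs i).2.2.2 n).subset ?_) hinj.injOn
  rintro _ ⟨j, ⟨hj, hj'⟩, rfl⟩
  exact ⟨Or.inr ⟨j, hj, rfl⟩, hj'⟩

end Hilbert

/-- The Farah–Wofsey conjecture: there are `ℵ₁` projections on a separable
infinite-dimensional Hilbert space whose images in the Calkin algebra are pairwise orthogonal
and pairwise distinct, such that for every commutative C*-subalgebra `A` of `B(H)` only
countably many of them agree with an element of `A` modulo compacts. -/
theorem exists_projections_countable_in_commutative_subalgebras
    {H : Type*} [NormedAddCommGroup H] [InnerProductSpace ℂ H] [CompleteSpace H]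
    [TopologicalSpace.SeparableSpace H] (hH : ¬ FiniteDimensional ℂ H) :
    ∃ P : {α : Ordinal // α < ω₁} → H →L[ℂ] H,
      (∀ α, IsSelfAdjoint (P α) ∧ IsIdempotentElem (P α)) ∧
      (∀ α, ¬ IsCompactOperator (P α : H →L[ℂ] H)) ∧
      (∀ α β, α ≠ β → IsCompactOperator (P α * P β : H →L[ℂ] H)) ∧
      (∀ α β, α ≠ β → ¬ IsCompactOperator (P α - P β : H →L[ℂ] H)) ∧
      (∀ A : NonUnitalStarSubalgebra ℂ (H →L[ℂ] H),
        IsClosed (A : Set (H →L[ℂ] H)) →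
        (∀ a ∈ A, ∀ b ∈ A, a * b = b * a) →
        {α : {α : Ordinal // α < ω₁} |
          ∃ a ∈ A, IsCompactOperator (P α - a : H →L[ℂ] H)}.Countable) := by
  have hι : ∀ i : {α : Ordinal // α < ω₁}, (Set.Iio i).Countable := fun i => by
    have h : (Set.Iio i.1).Countable := by
      rw [← Cardinal.le_aleph0_iff_set_countable, Cardinal.mk_Iio_ordinal,
        Cardinal.lift_le_aleph0, ← Order.lt_succ_iff, Cardinal.succ_aleph0]
      exact Cardinal.lt_omega_iff_card_lt.1 i.2
    exact (h.preimage Subtype.val_injective).mono fun j hj => hj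
  have hd := TopologicalSpace.denseRange_denseSeq H
  obtain ⟨P, hP, hc, ho, hL⟩ := exists_family hι hd hH
  refine ⟨P, fun i => ⟨(hP i).isSelfAdjoint, (hP i).isIdempotentElem⟩, hc, ho,
    fun i j hij hcomp => ?_, fun A _ hA => ?_⟩
  · have h1 : IsCompactOperator (P j * (P i - P j) : H →L[ℂ] H) := hcomp.clm_comp (P j)
    have h2 := (ho j i hij.symm).sub h1
    have h3 : P j * P i - P j * (P i - P j) = P j := by
      rw [mul_sub, (hP j).isIdempotentElem.eq, sub_sub_cancel]
    rw [← FunLike.coe_sub, h3] at h2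
    exact hc j h2
  · let X : ℕ → Set {α : Ordinal // α < ω₁} := fun n => {i | ∃ a ∈ A, ∀ x : H, ‖x‖ = 1 →
      (∀ k < n, inner ℂ (TopologicalSpace.denseSeq H k) x = 0) →
      ‖(P i - a) x‖ ≤ 1 / 20 ∧ ‖ContinuousLinearMap.adjoint (P i - a) x‖ ≤ 1 / 20}
    have hX : ∀ n, (X n).Countable := fun n => by
      refine Set.countable_of_forall_finite_inter_Iio _ fun i hi => (hL i n).subset ?_
      rintro j ⟨hj, hji⟩
      obtain ⟨a, haA, ha⟩ := hi
      obtain ⟨b, hbA, hb⟩ := hj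
      exact ⟨hji, not_largeCommutator (hP i) (hP j) (hA a haA b hbA) ha hb⟩
    refine (Set.countable_iUnion hX).mono ?_
    rintro i ⟨a, haA, ha⟩
    obtain ⟨n, hn⟩ := ha.exists_norm_apply_le hd (ε := 1 / 20) (by norm_num)
    exact Set.mem_iUnion.2 ⟨n, a, haA, hn⟩
end
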